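/- arXiv:2110.06412 — 2 statements merged into one kernel-verified Lean document; each statement's English description precedes it below -/
import Mathlib

section
/- Let m, σ > 0 satisfy Q(m/σ) ≥ 1/4 (equivalently m/σ ≤ Q⁻¹(1/4) ≈ 0.6745). Then the OSGT distribution is σ²-sub-Gaussian in the sense that for every y > 0, the tail probability ∫_y^∞ f(t) dt = Q((m+y)/σ)/(2Q(m/σ)) is at most exp(-y²/(2σ²)). -/
open MeasureTheory Real Filter Set

/-- The Gaussian Q-function: `Q x = (1/√(2π)) ∫_x^∞ exp (-t²/2) dt`. -/
noncomputable def gaussQ (x : ℝ) : ℝ :=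
  (1 / Real.sqrt (2 * Real.pi)) * ∫ t in Set.Ioi x, Real.exp (-t ^ 2 / 2)

/-- The standard normal CDF: `Φ x = (1/√(2π)) ∫_{-∞}^x exp (-t²/2) dt`. -/
noncomputable def stdPhi (x : ℝ) : ℝ :=
  (1 / Real.sqrt (2 * Real.pi)) * ∫ t in Set.Iic x, Real.exp (-t ^ 2 / 2)

/-- The offset-symmetric Gaussian tails (OSGT) density with parameters `m`, `σ`,
with normalization constant `S = 2√(2πσ²) Q(m/σ)`. -/
noncomputable def osgt (m σ y : ℝ) : ℝ :=
  if y ≤ 0 then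
    Real.exp (-(y - m) ^ 2 / (2 * σ ^ 2)) /
      (2 * Real.sqrt (2 * Real.pi * σ ^ 2) * gaussQ (m / σ))
  else
    Real.exp (-(y + m) ^ 2 / (2 * σ ^ 2)) /
      (2 * Real.sqrt (2 * Real.pi * σ ^ 2) * gaussQ (m / σ))

/-- Translation of the variable in an integral over a right half-line. -/
lemma setIntegral_Ioi_comp_add_right (g : ℝ → ℝ) (a c : ℝ) :
    (∫ t in Ioi a, g (t + c)) = ∫ t in Ioi (a + c), g t := by
  have h := (measurePreserving_add_right volume c).setIntegral_preimage_emb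
    (measurableEmbedding_addRight c) g (Ioi (a + c))
  simpa using h

lemma integrable_exp_neg_sq_div_two : Integrable fun t : ℝ => Real.exp (-t ^ 2 / 2) := by
  refine (integrable_exp_neg_mul_sq (b := 1 / 2) (by norm_num)).congr (ae_of_all _ fun t => ?_)
  simp only
  congr 1
  ring

lemma gaussQ_add_le {a b : ℝ} (ha : 0 ≤ a) (hb : 0 ≤ b) :
    gaussQ (a + b) ≤ Real.exp (-b ^ 2 / 2) * gaussQ a := by
  unfold gaussQ
  rw [mul_left_comm, ← setIntegral_Ioi_comp_add_right (fun t => Real.exp (-t ^ 2 / 2)) a b]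
  refine mul_le_mul_of_nonneg_left ?_ (by positivity : (0 : ℝ) ≤ 1 / Real.sqrt (2 * Real.pi))
  rw [← integral_const_mul]
  refine setIntegral_mono_on
    (integrable_exp_neg_sq_div_two.comp_add_right b).integrableOn
    (integrable_exp_neg_sq_div_two.const_mul _).integrableOn measurableSet_Ioi
    fun t ht => ?_
  rw [← Real.exp_add]
  refine Real.exp_le_exp.mpr ?_
  nlinarith [mul_nonneg (ha.trans (mem_Ioi.mp ht).le) hb]

lemma integral_Ioi_exp_neg_add_sq (m y : ℝ) {σ : ℝ} (hσ : 0 < σ) :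
    (∫ t in Ioi y, Real.exp (-(t + m) ^ 2 / (2 * σ ^ 2))) =
      Real.sqrt (2 * Real.pi * σ ^ 2) * gaussQ ((m + y) / σ) := by
  rw [setIntegral_Ioi_comp_add_right (fun t => Real.exp (-t ^ 2 / (2 * σ ^ 2))) y m]
  have h := integral_comp_mul_left_Ioi (fun t : ℝ => Real.exp (-t ^ 2 / 2)) (y + m)
    (inv_pos.mpr hσ)
  have e : (fun t : ℝ => Real.exp (-t ^ 2 / (2 * σ ^ 2))) =
      fun t => Real.exp (-(σ⁻¹ * t) ^ 2 / 2) := by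
    funext t
    congr 1
    field_simp
  have e' : σ⁻¹ * (y + m) = (m + y) / σ := by ring
  rw [e, h, e', Real.sqrt_mul (by positivity), Real.sqrt_sq hσ.le, gaussQ, inv_inv, smul_eq_mul]
  have : Real.sqrt (2 * Real.pi) ≠ 0 := by positivity
  field_simp

lemma integral_Ioi_osgt (m : ℝ) {σ y : ℝ} (hσ : 0 < σ) (hy : 0 ≤ y) :
    (∫ t in Ioi y, osgt m σ t) = gaussQ ((m + y) / σ) / (2 * gaussQ (m / σ)) := by
  have h : (∫ t in Ioi y, osgt m σ t) = ∫ t in Ioi y, Real.exp (-(t + m) ^ 2 / (2 * σ ^ 2)) /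
      (2 * Real.sqrt (2 * Real.pi * σ ^ 2) * gaussQ (m / σ)) :=
    setIntegral_congr_fun measurableSet_Ioi fun t ht =>
      if_neg (not_le.mpr (hy.trans_lt (mem_Ioi.mp ht)))
  rw [h, integral_div, integral_Ioi_exp_neg_add_sq m y hσ]
  have hs : Real.sqrt (2 * Real.pi * σ ^ 2) ≠ 0 := by positivity
  rw [mul_comm 2 (Real.sqrt _), mul_assoc (Real.sqrt _), mul_div_mul_left _ _ hs]

/-- sub-Gaussian tail of the OSGT distribution when `Q(m/σ) ≥ 1/4`. -/
theorem osgt_subGaussian (m σ : ℝ) (hm : 0 < m) (hσ : 0 < σ)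
    (hQ : gaussQ (m / σ) ≥ 1 / 4) (y : ℝ) (hy : 0 < y) :
    (∫ t in Set.Ioi y, osgt m σ t) = gaussQ ((m + y) / σ) / (2 * gaussQ (m / σ)) ∧
    (∫ t in Set.Ioi y, osgt m σ t) ≤ Real.exp (-y ^ 2 / (2 * σ ^ 2)) := by
  have htail := integral_Ioi_osgt m hσ hy.le
  refine ⟨htail, ?_⟩
  have hpos : 0 < gaussQ (m / σ) := by linarith
  have hle := gaussQ_add_le (div_pos hm hσ).le (div_pos hy hσ).le
  have e : -(y / σ) ^ 2 / 2 = -y ^ 2 / (2 * σ ^ 2) := by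
    field_simp
  rw [← add_div, e] at hle
  rw [htail, div_le_iff₀ (by positivity)]
  nlinarith [mul_pos (Real.exp_pos (-y ^ 2 / (2 * σ ^ 2))) hpos]
end

section
/- Let m, σ, Δ, ε > 0 and define δ(ε) as follows: if σ²ε/Δ ≤ Δ/2 + m, then δ(ε) = 1 - (1/(2Q(m/σ)))·(Q((2m+Δ)/(2σ) - εσ/(2m+Δ)) + e^ε·Q((2m+Δ)/(2σ) + εσ/(2m+Δ))); if σ²ε/Δ > Δ/2 + m, then δ(ε) = (1/(2Q(m/σ)))·(Q(εσ/Δ - Δ/(2σ)) - e^ε·Q(εσ/Δ + Δ/(2σ))). Then for every pair q, q' ∈ ℝ with |q - q'| ≤ Δ and every measurable set E ⊆ ℝ, it holds that ∫_E f_q(y) dy ≤ e^ε · ∫_E f_{q'}(y) dy + δ(ε), i.e., the single-dimensional OSGT mechanism with query sensitivity Δ satisfies (ε, δ(ε))-differential privacy. -/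
open MeasureTheory Real Filter Set

/-- If `g` is nonnegative on `V` and nonpositive off `V`, then `V` maximizes the set integral. -/
lemma setIntegral_le_of_sign {g : ℝ → ℝ} (hg : Integrable g) {U V : Set ℝ}
    (hU : MeasurableSet U) (hV : MeasurableSet V) (hpos : ∀ y ∈ V, 0 ≤ g y)
    (hneg : ∀ y ∉ V, g y ≤ 0) : ∫ y in U, g y ≤ ∫ y in V, g y := by
  rw [← integral_indicator hU, ← integral_indicator hV]
  refine integral_mono (hg.indicator hU) (hg.indicator hV) fun y => ?_
  by_cases h1 : y ∈ U <;> by_cases h2 : y ∈ V <;> simp [h1, h2, hpos, hneg]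

lemma setIntegral_preimage_sub_right (g : ℝ → ℝ) (c : ℝ) (E : Set ℝ) :
    ∫ y in (fun y => y - c) ⁻¹' E, g (y - c) = ∫ y in E, g y :=
  (measurePreserving_sub_right volume c).setIntegral_preimage_emb
    (measurableEmbedding_subRight c) g E

lemma gaussQ_pos (x : ℝ) : 0 < gaussQ x := by
  have hint : Integrable fun t : ℝ => Real.exp (-t ^ 2 / 2) :=
    (integrable_exp_neg_mul_sq (b := 1 / 2) (by norm_num)).congr
      (.of_forall fun t => by ring_nf)
  refine mul_pos (by positivity) ?_
  rw [setIntegral_pos_iff_support_of_nonneg_ae (.of_forall fun t => (Real.exp_pos _).le)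
    hint.integrableOn]
  have : Function.support (fun t : ℝ => Real.exp (-t ^ 2 / 2)) = univ :=
    Function.support_eq_univ fun t => (Real.exp_pos _).ne'
  simp [this]

section OSGT

variable {m σ : ℝ}

lemma osgt_eq_exp_abs (m σ y : ℝ) :
    osgt m σ y = Real.exp (-(|y| + m) ^ 2 / (2 * σ ^ 2)) /
      (2 * Real.sqrt (2 * Real.pi * σ ^ 2) * gaussQ (m / σ)) := by
  unfold osgt
  split_ifs with h
  · rw [abs_of_nonpos h]
    ring_nf
  · rw [abs_of_pos (not_le.mp h)]

lemma osgt_neg (m σ y : ℝ) : osgt m σ (-y) = osgt m σ y := by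
  simp only [osgt_eq_exp_abs, abs_neg]

lemma osgt_norm_pos (hσ : 0 < σ) :
    0 < 2 * Real.sqrt (2 * Real.pi * σ ^ 2) * gaussQ (m / σ) :=
  mul_pos (by positivity) (gaussQ_pos _)

lemma osgt_nonneg (hσ : 0 < σ) (y : ℝ) : 0 ≤ osgt m σ y := by
  rw [osgt_eq_exp_abs]
  exact div_nonneg (Real.exp_pos _).le (osgt_norm_pos hσ).le

lemma integrable_osgt (hm : 0 < m) (hσ : 0 < σ) : Integrable (osgt m σ) := by
  rw [funext (osgt_eq_exp_abs m σ)]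
  refine Integrable.div_const ?_ _
  refine (integrable_exp_neg_mul_sq (b := 1 / (2 * σ ^ 2)) (by positivity)).mono'
    (by fun_prop) (.of_forall fun y => ?_)
  rw [Real.norm_of_nonneg (Real.exp_pos _).le, Real.exp_le_exp, neg_mul, one_div_mul_eq_div,
    ← neg_div]
  refine div_le_div_of_nonneg_right ?_ (by positivity)
  nlinarith [sq_abs y, abs_nonneg y]

lemma exp_mul_osgt (hσ : 0 < σ) (ε y : ℝ) :
    Real.exp ε * osgt m σ y = Real.exp ((2 * σ ^ 2 * ε - (|y| + m) ^ 2) / (2 * σ ^ 2)) /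
      (2 * Real.sqrt (2 * Real.pi * σ ^ 2) * gaussQ (m / σ)) := by
  rw [osgt_eq_exp_abs, ← mul_div_assoc, ← Real.exp_add]
  congr 2
  field_simp
  ring

lemma osgt_le_exp_mul_osgt_iff (hσ : 0 < σ) (ε x y : ℝ) :
    osgt m σ x ≤ Real.exp ε * osgt m σ y ↔
      (|y| + m) ^ 2 - (|x| + m) ^ 2 ≤ 2 * σ ^ 2 * ε := by
  rw [exp_mul_osgt hσ, osgt_eq_exp_abs, div_le_div_iff_of_pos_right (osgt_norm_pos hσ),
    Real.exp_le_exp, div_le_div_iff_of_pos_right (by positivity)]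
  constructor <;> intro h <;> linarith

lemma exp_mul_osgt_le_osgt_iff (hσ : 0 < σ) (ε x y : ℝ) :
    Real.exp ε * osgt m σ y ≤ osgt m σ x ↔
      2 * σ ^ 2 * ε ≤ (|y| + m) ^ 2 - (|x| + m) ^ 2 := by
  rw [exp_mul_osgt hσ, osgt_eq_exp_abs, div_le_div_iff_of_pos_right (osgt_norm_pos hσ),
    Real.exp_le_exp, div_le_div_iff_of_pos_right (by positivity)]
  constructor <;> intro h <;> linarith

/-- The log-likelihood ratio between an OSGT density and its right translate is monotone. -/
lemma monotone_osgt_logRatio (hm : 0 < m) {a : ℝ} (ha : 0 ≤ a) :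
    Monotone fun y : ℝ => (|y| + m) ^ 2 - (|y - a| + m) ^ 2 := by
  intro x y hxy
  have habs : |x| - |x - a| ≤ |y| - |y - a| := by
    rcases abs_cases x with h1 | h1 <;> rcases abs_cases (x - a) with h2 | h2 <;>
      rcases abs_cases y with h3 | h3 <;> rcases abs_cases (y - a) with h4 | h4 <;> linarith
  have := mul_le_mul_of_nonneg_left habs hm.le
  have := mul_le_mul_of_nonneg_left hxy ha
  simp only
  nlinarith [sq_abs x, sq_abs y, sq_abs (x - a), sq_abs (y - a)]

lemma setIntegral_Ioi_osgt_of_nonneg (hσ : 0 < σ) {s : ℝ} (hs : 0 ≤ s) :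
    ∫ y in Ioi s, osgt m σ y = gaussQ ((s + m) / σ) / (2 * gaussQ (m / σ)) := by
  have h1 : ∫ y in Ioi s, osgt m σ y =
      ∫ y in (fun y => y - -m) ⁻¹' Ioi (s + m),
        (fun z => Real.exp (-(z * σ⁻¹) ^ 2 / 2)) (y - -m) /
          (2 * Real.sqrt (2 * Real.pi * σ ^ 2) * gaussQ (m / σ)) := by
    have : (fun y => y - -m) ⁻¹' Ioi (s + m) = Ioi s := by ext; simp
    rw [this]
    refine setIntegral_congr_fun measurableSet_Ioi fun y hy => ?_
    rw [osgt_eq_exp_abs, abs_of_pos (hs.trans_lt hy)]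
    simp only [sub_neg_eq_add]
    congr 2
    field_simp
  rw [h1, integral_div,
    setIntegral_preimage_sub_right (fun z => Real.exp (-(z * σ⁻¹) ^ 2 / 2)),
    integral_comp_mul_right_Ioi (fun t => Real.exp (-t ^ 2 / 2)) _ (inv_pos.2 hσ)]
  have hQ := gaussQ_pos (m / σ)
  rw [show gaussQ ((s + m) / σ) = (1 / Real.sqrt (2 * Real.pi)) *
    ∫ t in Ioi ((s + m) / σ), Real.exp (-t ^ 2 / 2) from rfl,
    Real.sqrt_mul (by positivity), Real.sqrt_sq hσ.le, inv_inv, smul_eq_mul, ← div_eq_mul_inv]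
  field_simp

lemma setIntegral_Iic_osgt (m σ s : ℝ) :
    ∫ y in Iic s, osgt m σ y = ∫ y in Ioi (-s), osgt m σ y := by
  rw [← integral_comp_neg_Iic]
  simp only [osgt_neg]

lemma integral_osgt (hm : 0 < m) (hσ : 0 < σ) : ∫ y, osgt m σ y = 1 := by
  have hf := integrable_osgt hm hσ
  have hQ := gaussQ_pos (m / σ)
  rw [← integral_add_compl (measurableSet_Iic (a := (0 : ℝ))) hf, compl_Iic,
    setIntegral_Iic_osgt, neg_zero, setIntegral_Ioi_osgt_of_nonneg hσ le_rfl, zero_add]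
  field_simp
  norm_num

lemma setIntegral_Ioi_osgt_of_nonpos (hm : 0 < m) (hσ : 0 < σ) {s : ℝ} (hs : s ≤ 0) :
    ∫ y in Ioi s, osgt m σ y = 1 - gaussQ ((-s + m) / σ) / (2 * gaussQ (m / σ)) := by
  have h := integral_add_compl (measurableSet_Iic (a := s)) (integrable_osgt hm hσ)
  rw [compl_Iic, setIntegral_Iic_osgt, integral_osgt hm hσ,
    setIntegral_Ioi_osgt_of_nonneg hσ (neg_nonneg.2 hs)] at h
  linarith

lemma setIntegral_osgt_sub (hm : 0 < m) (hσ : 0 < σ) (ε a : ℝ) (U : Set ℝ) :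
    ∫ y in U, (osgt m σ (y - a) - Real.exp ε * osgt m σ y) =
      (∫ y in U, osgt m σ (y - a)) - Real.exp ε * ∫ y in U, osgt m σ y := by
  rw [integral_sub, integral_const_mul]
  · exact ((integrable_osgt hm hσ).comp_sub_right a).integrableOn
  · exact ((integrable_osgt hm hσ).const_mul _).integrableOn

lemma integrable_osgt_sub (hm : 0 < m) (hσ : 0 < σ) (ε a : ℝ) :
    Integrable fun y => osgt m σ (y - a) - Real.exp ε * osgt m σ y :=
  ((integrable_osgt hm hσ).comp_sub_right a).sub ((integrable_osgt hm hσ).const_mul _)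

/-- When the log-likelihood ratio crosses the level `ε` at `t`, the half-line `(t, ∞)` attains
the hockey-stick divergence. -/
lemma setIntegral_osgt_sub_le (hm : 0 < m) (hσ : 0 < σ) {ε a t : ℝ} (ha : 0 ≤ a)
    (ht : (|t| + m) ^ 2 - (|t - a| + m) ^ 2 = 2 * σ ^ 2 * ε) {U : Set ℝ}
    (hU : MeasurableSet U) :
    (∫ y in U, osgt m σ (y - a)) - Real.exp ε * ∫ y in U, osgt m σ y ≤
      (∫ y in Ioi (t - a), osgt m σ y) - Real.exp ε * ∫ y in Ioi t, osgt m σ y := by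
  have hmono := monotone_osgt_logRatio hm ha
  have hpre : (fun y => y - a) ⁻¹' Ioi (t - a) = Ioi t := by ext; simp
  rw [← setIntegral_preimage_sub_right (osgt m σ) a (Ioi (t - a)), hpre, ← setIntegral_osgt_sub hm hσ,
    ← setIntegral_osgt_sub hm hσ]
  refine setIntegral_le_of_sign (integrable_osgt_sub hm hσ ε a) hU measurableSet_Ioi
    (fun y hy => sub_nonneg.2 ?_) (fun y hy => sub_nonpos.2 ?_)
  · exact (exp_mul_osgt_le_osgt_iff hσ _ _ _).2 (ht.ge.trans (hmono (le_of_lt hy)))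
  · exact (osgt_le_exp_mul_osgt_iff hσ _ _ _).2 ((hmono (not_lt.1 hy)).trans ht.le)

/-- A hockey-stick bound for the shift `b` implies the same bound for every smaller shift. -/
lemma setIntegral_osgt_le_of_shift_le (hm : 0 < m) (hσ : 0 < σ) {ε a b δ : ℝ} (ha : 0 ≤ a)
    (hab : a ≤ b)
    (hb : ∀ U : Set ℝ, MeasurableSet U →
      (∫ y in U, osgt m σ (y - b)) - Real.exp ε * ∫ y in U, osgt m σ y ≤ δ)
    {E : Set ℝ} (hE : MeasurableSet E) :
    (∫ y in E, osgt m σ (y - a)) - Real.exp ε * ∫ y in E, osgt m σ y ≤ δ := by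
  set V : Set ℝ := {y | 2 * σ ^ 2 * ε ≤ (|y| + m) ^ 2 - (|y - a| + m) ^ 2}
  have hV : MeasurableSet V := measurableSet_le (by fun_prop) (by fun_prop)
  have hle := setIntegral_le_of_sign (integrable_osgt_sub hm hσ ε a) hE hV
    (fun y hy => sub_nonneg.2 ((exp_mul_osgt_le_osgt_iff hσ _ _ _).2 hy))
    (fun y hy => sub_nonpos.2 ((osgt_le_exp_mul_osgt_iff hσ _ _ _).2 (not_le.1 hy).le))
  rw [setIntegral_osgt_sub hm hσ, setIntegral_osgt_sub hm hσ] at hle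
  have hshift (c : ℝ) : ∫ y in V, osgt m σ (y - c) = ∫ y in (fun y => y + c) ⁻¹' V, osgt m σ y := by
    rw [← setIntegral_preimage_sub_right (osgt m σ) c]
    congr 2
    ext y
    simp
  have hVle : ∫ y in V, osgt m σ (y - a) ≤ ∫ y in V, osgt m σ (y - b) := by
    rw [hshift, hshift]
    refine setIntegral_mono_set (integrable_osgt hm hσ).integrableOn
      (.of_forall fun y => osgt_nonneg hσ y) (LE.le.eventuallyLE fun y hy => ?_)
    have hyV : y + a ∈ V := hy
    exact hyV.trans (monotone_osgt_logRatio hm ha (by linarith : y + a ≤ y + b))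
  linarith [hb V hV]

end OSGT

/-- the single-dimensional OSGT mechanism with query sensitivity `Δ`
satisfies `(ε, δ(ε))`-differential privacy. -/
theorem osgt_approx_dp (m σ Δ ε : ℝ) (hm : 0 < m) (hσ : 0 < σ) (hΔ : 0 < Δ) (hε : 0 < ε)
    (δ : ℝ)
    (hδ : δ = if σ ^ 2 * ε / Δ ≤ Δ / 2 + m then
        1 - (1 / (2 * gaussQ (m / σ))) *
          (gaussQ ((2 * m + Δ) / (2 * σ) - ε * σ / (2 * m + Δ)) +
            Real.exp ε * gaussQ ((2 * m + Δ) / (2 * σ) + ε * σ / (2 * m + Δ)))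
      else
        (1 / (2 * gaussQ (m / σ))) *
          (gaussQ (ε * σ / Δ - Δ / (2 * σ)) - Real.exp ε * gaussQ (ε * σ / Δ + Δ / (2 * σ)))) :
    ∀ q q' : ℝ, |q - q'| ≤ Δ → ∀ E : Set ℝ, MeasurableSet E →
      (∫ y in E, osgt m σ (y - q)) ≤ Real.exp ε * (∫ y in E, osgt m σ (y - q')) + δ := by
  have hsup : ∀ U : Set ℝ, MeasurableSet U →
      (∫ y in U, osgt m σ (y - Δ)) - Real.exp ε * ∫ y in U, osgt m σ y ≤ δ := by
    intro U hU
    split_ifs at hδ with hcase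
    · have hw : 0 < σ ^ 2 * ε / (2 * m + Δ) := by positivity
      have hw' : σ ^ 2 * ε / (2 * m + Δ) ≤ Δ / 2 := by
        rw [div_le_iff₀ hΔ] at hcase
        rw [div_le_iff₀ (by positivity)]
        linarith
      have hmul : σ ^ 2 * ε / (2 * m + Δ) * (2 * m + Δ) = σ ^ 2 * ε := by field_simp
      have ht : (|Δ / 2 + σ ^ 2 * ε / (2 * m + Δ)| + m) ^ 2 -
          (|Δ / 2 + σ ^ 2 * ε / (2 * m + Δ) - Δ| + m) ^ 2 = 2 * σ ^ 2 * ε := by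
        rw [abs_of_nonneg (by linarith), abs_of_nonpos (by linarith)]
        linear_combination 2 * hmul
      refine (setIntegral_osgt_sub_le hm hσ hΔ.le ht hU).trans_eq ?_
      rw [setIntegral_Ioi_osgt_of_nonpos hm hσ (by linarith),
        setIntegral_Ioi_osgt_of_nonneg hσ (by linarith), hδ,
        show (-(Δ / 2 + σ ^ 2 * ε / (2 * m + Δ) - Δ) + m) / σ =
          (2 * m + Δ) / (2 * σ) - ε * σ / (2 * m + Δ) by field_simp; ring,
        show (Δ / 2 + σ ^ 2 * ε / (2 * m + Δ) + m) / σ =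
          (2 * m + Δ) / (2 * σ) + ε * σ / (2 * m + Δ) by field_simp; ring]
      ring
    · rw [not_le] at hcase
      have hmul : σ ^ 2 * ε / Δ * Δ = σ ^ 2 * ε := by field_simp
      have ht : (|Δ / 2 - m + σ ^ 2 * ε / Δ| + m) ^ 2 -
          (|Δ / 2 - m + σ ^ 2 * ε / Δ - Δ| + m) ^ 2 = 2 * σ ^ 2 * ε := by
        rw [abs_of_nonneg (by linarith), abs_of_nonneg (by linarith)]
        linear_combination 2 * hmul
      refine (setIntegral_osgt_sub_le hm hσ hΔ.le ht hU).trans_eq ?_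
      rw [setIntegral_Ioi_osgt_of_nonneg hσ (by linarith),
        setIntegral_Ioi_osgt_of_nonneg hσ (by linarith), hδ,
        show (Δ / 2 - m + σ ^ 2 * ε / Δ - Δ + m) / σ =
          ε * σ / Δ - Δ / (2 * σ) by field_simp; ring,
        show (Δ / 2 - m + σ ^ 2 * ε / Δ + m) / σ =
          ε * σ / Δ + Δ / (2 * σ) by field_simp; ring]
      ring
  have hordered : ∀ q q' : ℝ, q' ≤ q → q - q' ≤ Δ → ∀ E : Set ℝ, MeasurableSet E →
      (∫ y in E, osgt m σ (y - q)) ≤ Real.exp ε * (∫ y in E, osgt m σ (y - q')) + δ := by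
    intro q q' hle hqq E hE
    have h := setIntegral_osgt_le_of_shift_le hm hσ (sub_nonneg.2 hle) hqq hsup
      (E := (fun y => y - -q') ⁻¹' E) (measurable_id.sub_const _ hE)
    have e1 := setIntegral_preimage_sub_right (fun y => osgt m σ (y - q)) (-q') E
    have e2 := setIntegral_preimage_sub_right (fun y => osgt m σ (y - q')) (-q') E
    have e3 (y : ℝ) : y - -q' - q = y - (q - q') := by ring
    have e4 (y : ℝ) : y - -q' - q' = y := by ring
    simp only [e3] at e1
    simp only [e4] at e2
    rw [e1, e2] at h
    linarith
  intro q q' hqq E hE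
  rw [abs_le] at hqq
  rcases le_total q' q with hle | hle
  · exact hordered q q' hle hqq.2 E hE
  · have hreflect (c : ℝ) :
        ∫ y in Neg.neg ⁻¹' E, osgt m σ (y - -c) = ∫ y in E, osgt m σ (y - c) := by
      rw [← (Measure.measurePreserving_neg volume).setIntegral_preimage_emb
        (MeasurableEquiv.neg ℝ).measurableEmbedding (fun y => osgt m σ (y - c)) E]
      refine integral_congr_ae (.of_forall fun y => ?_)
      simp only
      rw [← osgt_neg]
      congr 1
      ring
    have h := hordered (-q) (-q') (by linarith) (by linarith) (Neg.neg ⁻¹' E)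
      (measurable_neg hE)
    rwa [hreflect, hreflect] at h
end
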